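/- Explicit form of the Lax matrices: let Q^a(λ_a) = Σ_{n≥−N_a} Q^a_n λ_a^n be the components of a gl_N-valued adelic element, and define V^b(λ;μ_b) := Tr₂( ι_{μ_b} r₁₂(λ,μ) Q^b(μ_b)₂ ) with expansion V^b(λ;μ_b) = Σ_{n≥−N_b} V^b_n(λ) μ_b^n for b ∈ ℂ and V^∞(λ;μ_∞) = Σ_{n≥−N_∞} V^∞_n(λ) μ_∞^{n+k+1} (k = 0 rational case, k = −1 trigonometric case). Then: in the rational case (r = r^rat), for every a ∈ ℂ and n ≥ −N_a, V^a_n(λ) = −( λ_a^{−n−1} Q^a(λ_a) )^rat_−, and at infinity, for n ≥ −N_∞, V^∞_n(λ) = ( λ_∞^{−n} Q^∞(λ_∞) )^rat_−; in the trigonometric case (r = r^trig), for every a ∈ ℂ and n ≥ −N_a, V^a_n(λ) = −( (λ_a^{−n} + a λ_a^{−n−1}) Q^a(λ_a) )^trig_− (which at a = 0 reads V^0_n(λ) = −( λ^{−n} Q^0(λ) )^trig_−), and at infinity, for n ≥ −N_∞, V^∞_n(λ) = ( λ_∞^{−n} Q^∞(λ_∞) )^trig_−. -/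

import Mathlib

/-!
# Explicit form of the Lax matrices

Let `Q^a(λ_a) = Σ_{n≥−Nb a} Q^a_n λ_a^n` be the components of a `gl_N`-valued adelic
element and `V^b(λ;μ_b) := Tr₂( ι_{μ_b} r₁₂(λ,μ) Q^b(μ_b)₂ )`, expanded as
`V^b(λ;μ_b) = Σ_n V^b_n(λ) μ_b^n` (`b ∈ ℂ`) and `V^∞(λ;μ_∞) = Σ_n V^∞_n(λ) μ_∞^{n+k+1}`
(`k = 0` rational case, `k = −1` trigonometric case), where `ι_{μ_b}` expands the scalar
factor of the kernel as a `μ_b`-series with coefficients rational in `λ`, and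
`Tr₂(ι_{μ_b} r₁₂ Q₂) = (ι_{μ_b}(scalar kernel))·Q^b(μ_b) − [trig] (P⁻+½P⁰)Q^b(μ_b)`.

Then, rational case: `V^a_n(λ) = −( λ_a^{−n−1} Q^a(λ_a) )^rat_−` for `a ∈ ℂ`, and
`V^∞_n(λ) = ( λ_∞^{−n} Q^∞(λ_∞) )^rat_−`; trigonometric case:
`V^a_n(λ) = −( (λ_a^{−n} + a λ_a^{−n−1}) Q^a(λ_a) )^trig_−` for `a ∈ ℂ` and
`V^∞_n(λ) = ( λ_∞^{−n} Q^∞(λ_∞) )^trig_−`, as `gl_N`-valued rational functions of `λ`.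
-/

set_option synthInstance.maxHeartbeats 400000
noncomputable section
open Polynomial

abbrev Rf : Type := RatFunc ℂ
abbrev Rf2 : Type := RatFunc Rf
/-- `ℂP¹ = ℂ ∪ {∞}`; `none` is the point at infinity -/
abbrev CP1 : Type := Option ℂ
abbrev glC (N : ℕ) : Type := Matrix (Fin N) (Fin N) ℂ

def laurentCoeffAt {F : Type*} [Field F] (b : F) (f : RatFunc F) (n : ℤ) : F :=
  ((RatFunc.laurent b f : LaurentSeries F)).coeff n

def invSubst {F : Type*} [Field F] (f : RatFunc F) : RatFunc F :=
  (algebraMap F[X] (RatFunc F) f.num.reverse * RatFunc.X ^ f.denom.natDegree) /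
    (algebraMap F[X] (RatFunc F) f.denom.reverse * RatFunc.X ^ f.num.natDegree)

def expC {F : Type*} [Field F] (a : Option F) (f : RatFunc F) (n : ℤ) : F :=
  match a with
  | some b => laurentCoeffAt b f n
  | none => ((invSubst f : LaurentSeries F)).coeff n

def pt (b : CP1) : Option Rf := b.map (algebraMap ℂ Rf)

/-- scalar kernel of the r-matrix, outer variable `μ` -/
def kerS (isTrig : Bool) : Rf2 :=
  if isTrig then RatFunc.X * (RatFunc.X - RatFunc.C (RatFunc.X : Rf))⁻¹
  else (RatFunc.X - RatFunc.C (RatFunc.X : Rf))⁻¹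

def gker (isTrig : Bool) (b : CP1) (p : ℤ) : Rf := expC (pt b) (kerS isTrig) p

def kval (isTrig : Bool) : ℤ := if isTrig then -1 else 0
def idx (isTrig : Bool) (b : CP1) (n : ℤ) : ℤ := if b = none then n + kval isTrig + 1 else n

def lowP {N : ℕ} (M : glC N) : glC N := Matrix.of fun i j => if j < i then M i j else 0
def upP {N : ℕ} (M : glC N) : glC N := Matrix.of fun i j => if i < j then M i j else 0
def diagP {N : ℕ} (M : glC N) : glC N := Matrix.of fun i j => if i = j then M i j else 0

/-- lift of a constant matrix to a matrix of rational functions -/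
def lift {N : ℕ} (M : glC N) : Matrix (Fin N) (Fin N) Rf := M.map (algebraMap ℂ Rf)

/-- the Lax matrix `V^b_n(λ)`: the coefficient of `μ_b^n` (resp. `μ_∞^{n+k+1}`) of
`Tr₂( ι_{μ_b} r₁₂(λ,μ) Q^b(μ_b)₂ )`, a `gl_N`-valued rational function of `λ` -/
def Vlax {N : ℕ} (isTrig : Bool) (Q : CP1 → ℤ → glC N) (b : CP1) (n : ℤ) :
    Matrix (Fin N) (Fin N) Rf :=
  (∑ᶠ p : ℤ, gker isTrig b p • lift (Q b (idx isTrig b n - p)))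
    - (if isTrig then
        lift (lowP (Q b (idx isTrig b n)) + (2:ℂ)⁻¹ • diagP (Q b (idx isTrig b n)))
      else 0)

/-- rational pole part at `a ∈ ℂ` of the `λ_a`-Laurent series with coefficients `c`,
as a rational function -/
def ratNegAtRf {N : ℕ} (a : ℂ) (c : ℤ → glC N) : Matrix (Fin N) (Fin N) Rf :=
  ∑ᶠ u : ℤ, if u < 0 then (((RatFunc.X : Rf) - RatFunc.C a) ^ u) • lift (c u) else 0

/-- rational pole part at `∞` (powers `λ_∞^u = λ^{-u}`, `u ≤ 0`) -/
def ratNegInfRf {N : ℕ} (c : ℤ → glC N) : Matrix (Fin N) (Fin N) Rf :=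
  ∑ᶠ u : ℤ, if u ≤ 0 then ((RatFunc.X : Rf) ^ (-u)) • lift (c u) else 0

/-- trigonometric pole part at `a ∈ ℂ` (cases `a = 0` and `a ∈ ℂ×`) -/
def trigNegAtRf {N : ℕ} (a : ℂ) (c : ℤ → glC N) : Matrix (Fin N) (Fin N) Rf :=
  if a = 0 then
    lift (lowP (c 0) + (2:ℂ)⁻¹ • diagP (c 0))
      + ∑ᶠ u : ℤ, if u < 0 then ((RatFunc.X : Rf) ^ u) • lift (c u) else 0
  else
    (∑ᶠ u : ℤ, if u < 0 then (((RatFunc.X : Rf) - RatFunc.C a) ^ u) • lift (c u) else 0)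
      - lift (lowP (∑ᶠ u : ℤ, if u < 0 then ((-a) ^ u : ℂ) • c u else 0)
          + (2:ℂ)⁻¹ • diagP (∑ᶠ u : ℤ, if u < 0 then ((-a) ^ u : ℂ) • c u else 0))

/-- trigonometric pole part at `∞` -/
def trigNegInfRf {N : ℕ} (c : ℤ → glC N) : Matrix (Fin N) (Fin N) Rf :=
  lift (upP (c 0) + (2:ℂ)⁻¹ • diagP (c 0))
    + ∑ᶠ u : ℤ, if u < 0 then ((RatFunc.X : Rf) ^ (-u)) • lift (c u) else 0

lemma coe_div_eq_ofPowerSeries {F : Type*} [Field F] {p q : F[X]} (hq : q ≠ 0)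
    {S : PowerSeries F} (h : (q : PowerSeries F) * S = p) :
    (((algebraMap F[X] (RatFunc F) p / algebraMap F[X] (RatFunc F) q : RatFunc F)) :
      LaurentSeries F) = HahnSeries.ofPowerSeries ℤ F S := by
  have hq' : ((algebraMap F[X] (RatFunc F) q : RatFunc F) : LaurentSeries F) ≠ 0 := by
    simpa using hq
  have hc : ∀ P : F[X], ((algebraMap F[X] (RatFunc F) P : RatFunc F) : LaurentSeries F) =
      HahnSeries.ofPowerSeries ℤ F P := fun P => (RatFunc.coe_coe P).symm
  rw [map_div₀, div_eq_iff hq', hc, hc, ← h, map_mul, mul_comm]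

lemma coeff_coe_div {F : Type*} [Field F] {p q : F[X]} (hq : q ≠ 0)
    {S : PowerSeries F} (h : (q : PowerSeries F) * S = p) (n : ℤ) :
    (((algebraMap F[X] (RatFunc F) p / algebraMap F[X] (RatFunc F) q : RatFunc F)) :
      LaurentSeries F).coeff n = if 0 ≤ n then PowerSeries.coeff n.toNat S else 0 := by
  rw [coe_div_eq_ofPowerSeries hq h, PowerSeries.coeff_coe]
  rcases lt_or_ge n 0 with hn | hn
  · simp [hn]
  · rw [if_neg hn.not_gt, if_pos hn, show n.natAbs = n.toNat by omega]

lemma X_sub_C_mul_mk {F : Type*} [Field F] {d : F} (hd : d ≠ 0) :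
    ((X - C d : F[X]) : PowerSeries F) * PowerSeries.mk (fun m => -d ^ (-(m : ℤ) - 1)) = 1 := by
  ext m
  rcases m with _ | m
  · simp [sub_mul, hd]
  · simp only [coe_sub, coe_X, coe_C, sub_mul, map_sub, PowerSeries.coeff_succ_X_mul,
      PowerSeries.coeff_mk, PowerSeries.coeff_C_mul, PowerSeries.coeff_one]
    have : (-(m : ℤ) - 1) = 1 + (-((m + 1 : ℕ) : ℤ) - 1) := by push_cast; ring
    rw [this, zpow_add₀ hd]
    simp

lemma one_sub_C_mul_X_mul_mk {F : Type*} [Field F] (l : F) :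
    ((1 - C l * X : F[X]) : PowerSeries F) * PowerSeries.mk (fun m => l ^ m) = 1 := by
  ext m
  rcases m with _ | m
  · simp [sub_mul, mul_assoc]
  · simp [sub_mul, mul_assoc, PowerSeries.coeff_succ_X_mul, PowerSeries.coeff_one, pow_succ']

lemma invSubst_div {F : Type*} [Field F] {p q : F[X]} (hp : p ≠ 0) (hq : q ≠ 0) :
    invSubst (algebraMap F[X] (RatFunc F) p / algebraMap F[X] (RatFunc F) q) =
      algebraMap F[X] (RatFunc F) (p.reverse * X ^ q.natDegree) /
        algebraMap F[X] (RatFunc F) (q.reverse * X ^ p.natDegree) := by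
  set f := algebraMap F[X] (RatFunc F) p / algebraMap F[X] (RatFunc F) q with hf
  have hf0 : f ≠ 0 := by simp [hf, hp, hq]
  have hn : f.num ≠ 0 := RatFunc.num_ne_zero hf0
  have hd : f.denom ≠ 0 := f.denom_ne_zero
  have h : f.num * q = p * f.denom := (RatFunc.num_mul_eq_mul_denom_iff hq).2 hf
  have hr : f.num.reverse * q.reverse = p.reverse * f.denom.reverse := by
    rw [← reverse_mul_of_domain, h, reverse_mul_of_domain]
  have hdeg : f.num.natDegree + q.natDegree = p.natDegree + f.denom.natDegree := by
    rw [← natDegree_mul hn hq, h, natDegree_mul hp hd]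
  unfold invSubst
  rw [← RatFunc.algebraMap_X, ← map_pow, ← map_pow, ← map_mul, ← map_mul, div_eq_div_iff]
  · rw [← map_mul, ← map_mul]
    congr 1
    calc _ = (f.num.reverse * q.reverse) * X ^ (f.denom.natDegree + p.natDegree) := by ring
      _ = _ := by rw [hr, add_comm, ← hdeg]; ring
  · simp only [ne_eq, FaithfulSMul.algebraMap_eq_zero_iff]
    simp [hd]
  · simp only [ne_eq, FaithfulSMul.algebraMap_eq_zero_iff]
    simp [hq]

lemma reverse_X_eq_one {F : Type*} [Field F] : (X : F[X]).reverse = 1 := by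
  rw [← one_mul X, reverse_mul_X, ← C_1, reverse_C]

lemma reverse_X_sub_C {F : Type*} [Field F] (l : F) :
    (X - C l : F[X]).reverse = 1 - C l * X := by
  rw [sub_eq_add_neg, ← C_neg, reverse_add_C, reverse_X_eq_one]
  simp [sub_eq_add_neg]

lemma expC_kernel_at {F : Type*} [Field F] {b l : F} (h : l - b ≠ 0) (n : ℤ) :
    expC (some b) ((RatFunc.X - RatFunc.C l)⁻¹ : RatFunc F) n =
      if 0 ≤ n then -(l - b) ^ (-n - 1) else 0 := by
  have hl : RatFunc.laurent b ((RatFunc.X - RatFunc.C l)⁻¹ : RatFunc F) =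
      algebraMap F[X] (RatFunc F) 1 / algebraMap F[X] (RatFunc F) (X - C (l - b)) := by
    rw [map_inv₀, map_sub, RatFunc.laurent_X, RatFunc.laurent_C]
    simp [RatFunc.algebraMap_X, RatFunc.algebraMap_C]
    ring
  simp only [expC, laurentCoeffAt]
  rw [hl, coeff_coe_div (X_sub_C_ne_zero _) (by rw [X_sub_C_mul_mk h, coe_one])]
  refine ite_congr rfl (fun hn => ?_) fun _ => rfl
  rw [PowerSeries.coeff_mk, Int.toNat_of_nonneg hn]

lemma expC_trig_kernel_at {F : Type*} [Field F] {b l : F} (h : l - b ≠ 0) (n : ℤ) :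
    expC (some b) (RatFunc.X * (RatFunc.X - RatFunc.C l)⁻¹ : RatFunc F) n =
      -((if 1 ≤ n then (l - b) ^ (-n) else 0) +
        b * (if 0 ≤ n then (l - b) ^ (-n - 1) else 0)) := by
  have hl : RatFunc.laurent b (RatFunc.X * (RatFunc.X - RatFunc.C l)⁻¹ : RatFunc F) =
      algebraMap F[X] (RatFunc F) (X + C b) /
        algebraMap F[X] (RatFunc F) (X - C (l - b)) := by
    rw [map_mul, map_inv₀, map_sub, RatFunc.laurent_X, RatFunc.laurent_C]
    simp [RatFunc.algebraMap_X, RatFunc.algebraMap_C, div_eq_mul_inv]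
    left
    ring
  simp only [expC, laurentCoeffAt]
  rw [hl, coeff_coe_div (X_sub_C_ne_zero _)
    (by rw [mul_left_comm, X_sub_C_mul_mk h, mul_one] :
      _ * (((X + C b : F[X]) : PowerSeries F) * _) = _)]
  rcases lt_or_ge n 0 with hn | hn
  · rw [if_neg hn.not_ge, if_neg hn.not_ge, if_neg (by omega)]
    simp
  · lift n to ℕ using hn
    rcases n with _ | n
    · simp [add_mul]
    · have : (0 : ℤ) ≤ n + 1 := by omega
      have h2 : (-1 : ℤ) + -n = -n - 1 := by ring
      simp [add_mul, PowerSeries.coeff_succ_X_mul, this, h2]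
      ring

lemma expC_kernel_infty {F : Type*} [Field F] (l : F) (n : ℤ) :
    expC none ((RatFunc.X - RatFunc.C l)⁻¹ : RatFunc F) n =
      if 1 ≤ n then l ^ (n - 1) else 0 := by
  have hl : ((RatFunc.X - RatFunc.C l)⁻¹ : RatFunc F) =
      algebraMap F[X] (RatFunc F) 1 / algebraMap F[X] (RatFunc F) (X - C l) := by
    simp [RatFunc.algebraMap_X, RatFunc.algebraMap_C]
  have h0 : (1 - C l * X : F[X]) ≠ 0 := by
    rw [← reverse_X_sub_C, Ne, reverse_eq_zero]
    exact X_sub_C_ne_zero l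
  have hi : invSubst ((RatFunc.X - RatFunc.C l)⁻¹ : RatFunc F) =
      algebraMap F[X] (RatFunc F) X / algebraMap F[X] (RatFunc F) (1 - C l * X) := by
    rw [hl, invSubst_div one_ne_zero (X_sub_C_ne_zero _), reverse_X_sub_C, natDegree_X_sub_C,
      ← C_1, reverse_C, natDegree_C]
    simp
  simp only [expC]
  rw [hi, coeff_coe_div h0
    (by rw [mul_left_comm, one_sub_C_mul_X_mul_mk, mul_one] :
      _ * (((X : F[X]) : PowerSeries F) * _) = _)]
  rcases lt_or_ge n 0 with hn | hn
  · rw [if_neg hn.not_ge, if_neg (by omega)]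
  · lift n to ℕ using hn
    rcases n with _ | n
    · simp
    · have : (0 : ℤ) ≤ n + 1 := by omega
      simp [PowerSeries.coeff_succ_X_mul, this]

lemma expC_trig_kernel_infty {F : Type*} [Field F] (l : F) (n : ℤ) :
    expC none (RatFunc.X * (RatFunc.X - RatFunc.C l)⁻¹ : RatFunc F) n =
      if 0 ≤ n then l ^ n else 0 := by
  have hl : (RatFunc.X * (RatFunc.X - RatFunc.C l)⁻¹ : RatFunc F) =
      algebraMap F[X] (RatFunc F) X / algebraMap F[X] (RatFunc F) (X - C l) := by
    simp [RatFunc.algebraMap_X, RatFunc.algebraMap_C, div_eq_mul_inv]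
  have h0 : (1 - C l * X : F[X]) ≠ 0 := by
    rw [← reverse_X_sub_C, Ne, reverse_eq_zero]
    exact X_sub_C_ne_zero l
  have hi : invSubst (RatFunc.X * (RatFunc.X - RatFunc.C l)⁻¹ : RatFunc F) =
      algebraMap F[X] (RatFunc F) 1 / algebraMap F[X] (RatFunc F) (1 - C l * X) := by
    rw [hl, invSubst_div X_ne_zero (X_sub_C_ne_zero _), reverse_X_sub_C, natDegree_X_sub_C,
      natDegree_X, reverse_X_eq_one, map_mul, map_mul, mul_div_mul_right]
    rw [pow_one, RatFunc.algebraMap_X]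
    exact RatFunc.X_ne_zero
  simp only [expC]
  rw [hi, coeff_coe_div h0 (by rw [one_sub_C_mul_X_mul_mk, coe_one])]
  refine ite_congr rfl (fun hn => ?_) fun _ => rfl
  lift n to ℕ using hn
  simp

lemma X_sub_C_ne_zero_Rf (a : ℂ) : (RatFunc.X : Rf) - RatFunc.C a ≠ 0 := by
  rw [← RatFunc.algebraMap_X, ← RatFunc.algebraMap_C, ← map_sub, Ne,
    FaithfulSMul.algebraMap_eq_zero_iff]
  exact X_sub_C_ne_zero a

lemma gker_rat_at (a : ℂ) (p : ℤ) : gker false (some a) p =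
    if 0 ≤ p then -((RatFunc.X : Rf) - RatFunc.C a) ^ (-p - 1) else 0 :=
  expC_kernel_at (X_sub_C_ne_zero_Rf a) p

lemma gker_trig_at (a : ℂ) (p : ℤ) : gker true (some a) p =
    -((if 1 ≤ p then ((RatFunc.X : Rf) - RatFunc.C a) ^ (-p) else 0) +
      RatFunc.C a * (if 0 ≤ p then ((RatFunc.X : Rf) - RatFunc.C a) ^ (-p - 1) else 0)) :=
  expC_trig_kernel_at (X_sub_C_ne_zero_Rf a) p

lemma gker_rat_infty (p : ℤ) : gker false none p =
    if 1 ≤ p then (RatFunc.X : Rf) ^ (p - 1) else 0 :=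
  expC_kernel_infty RatFunc.X p

lemma gker_trig_infty (p : ℤ) : gker true none p =
    if 0 ≤ p then (RatFunc.X : Rf) ^ p else 0 :=
  expC_trig_kernel_infty RatFunc.X p

section Lift
variable {N : ℕ}

lemma lift_zero : lift (0 : glC N) = 0 := by
  ext i j; simp [lift]

lemma lift_add (A B : glC N) : lift (A + B) = lift A + lift B := by
  ext i j; simp [lift]

lemma lift_neg (A : glC N) : lift (-A) = -lift A := by
  ext i j; simp [lift]

lemma lift_smul (a : ℂ) (A : glC N) : lift (a • A) = (RatFunc.C a : Rf) • lift A := by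
  ext i j; simp [lift, RatFunc.algebraMap_eq_C]

lemma lowP_neg (A : glC N) : lowP (-A) = -lowP A := by
  ext i j; simp only [lowP, Matrix.of_apply, Matrix.neg_apply]; split_ifs <;> simp

lemma diagP_neg (A : glC N) : diagP (-A) = -diagP A := by
  ext i j; simp only [diagP, Matrix.of_apply, Matrix.neg_apply]; split_ifs <;> simp

lemma lowP_add_diagP_add_upP (A : glC N) : lowP A + diagP A + upP A = A := by
  ext i j
  simp only [lowP, diagP, upP, Matrix.of_apply, Matrix.add_apply]
  rcases lt_trichotomy i j with h | h | h
  · simp [h, h.not_gt, h.ne]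
  · simp [h]
  · simp [h, h.not_gt, h.ne']

end Lift

lemma support_finite_of_eq_zero {M : Type*} [Zero M] {f : ℤ → M} (L U : ℤ)
    (hL : ∀ u, u < L → f u = 0) (hU : ∀ u, U < u → f u = 0) : f.support.Finite := by
  refine (Set.finite_Icc L U).subset fun u hu => ⟨?_, ?_⟩ <;> by_contra! h
  exacts [hu (hL u h), hu (hU u h)]

/-- A telescoping sum: the polar part of the expansion at `a` of
`(1 + a λ_a⁻¹) · c`, evaluated at `λ = 0`. -/
lemma finsum_telescope {N : ℕ} {a : ℂ} (ha : a ≠ 0) (c : ℤ → glC N) (L : ℤ)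
    (hc : ∀ u, u < L → c u = 0) :
    (∑ᶠ u : ℤ, if u < 0 then ((-a) ^ u : ℂ) • (c u + a • c (u + 1)) else 0) = -c 0 := by
  set h : ℤ → glC N := fun u => if u < 0 then ((-a) ^ u : ℂ) • c u else 0 with hh
  set k : ℤ → glC N := fun u => if u < 1 then ((-a) ^ u : ℂ) • c u else 0 with hk
  have hfin : h.support.Finite := support_finite_of_eq_zero L 0
    (fun u hu => by simp [hh, hc u hu]) fun u hu => by simp [hh, hu.le]
  have hkfin : k.support.Finite := support_finite_of_eq_zero L 0
    (fun u hu => by simp [hk, hc u hu]) fun u hu => by simp only [hk]; rw [if_neg (by omega)]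
  have hk'fin : (fun u => k (u + 1)).support.Finite := support_finite_of_eq_zero (L - 1) (-1)
    (fun u hu => by simp [hk, hc (u + 1) (by omega)])
    fun u hu => by simp only [hk]; rw [if_neg (by omega)]
  have e1 : (fun u : ℤ => if u < 0 then ((-a) ^ u : ℂ) • (c u + a • c (u + 1)) else 0) =
      fun u => h u - k (u + 1) := by
    funext u
    by_cases hu : u < 0
    · simp only [hh, hk, hu, if_true, show u + 1 < 1 by omega]
      rw [zpow_add_one₀ (neg_ne_zero.2 ha), smul_add, smul_smul, mul_neg, neg_smul, sub_neg_eq_add]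
    · simp [hh, hk, hu]
  have e2 : ∑ᶠ u, k (u + 1) = ∑ᶠ u, k u := finsum_comp_equiv (Equiv.addRight (1 : ℤ))
  have e3 : ∑ᶠ u, k u - ∑ᶠ u, h u = c 0 := by
    rw [← finsum_sub_distrib hkfin hfin, finsum_eq_single _ 0]
    · simp [hh, hk]
    · intro u hu
      by_cases hu' : u < 0
      · simp [hh, hk, hu', show u < 1 by omega]
      · simp [hh, hk, hu', show ¬ u < 1 by omega]
  rw [e1, finsum_sub_distrib hfin hk'fin, e2, ← e3, neg_sub]

lemma Vlax_rat_at {N : ℕ} (Q : CP1 → ℤ → glC N) (a : ℂ) (n : ℤ) :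
    Vlax false Q (some a) n = - ratNegAtRf a (fun u => Q (some a) (u + n + 1)) := by
  rw [ratNegAtRf, ← finsum_neg_distrib, ← finsum_comp_equiv (Equiv.subLeft (-1 : ℤ))]
  simp only [Vlax, Bool.false_eq_true, if_false, sub_zero]
  refine finsum_congr fun p => ?_
  rw [gker_rat_at, Equiv.subLeft_apply]
  by_cases hp : 0 ≤ p
  · rw [if_pos hp, if_pos (by omega), show -p - 1 = -1 - p by ring, neg_smul]
    congr 4
    simp [idx]
    ring
  · rw [if_neg hp, if_neg (by omega)]
    simp

lemma Vlax_rat_infty {N : ℕ} (Q : CP1 → ℤ → glC N) (n : ℤ) :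
    Vlax false Q none n = ratNegInfRf (fun u => Q none (u + n)) := by
  rw [ratNegInfRf, ← finsum_comp_equiv (Equiv.subLeft (1 : ℤ))]
  simp only [Vlax, Bool.false_eq_true, if_false, sub_zero]
  refine finsum_congr fun p => ?_
  rw [gker_rat_infty, Equiv.subLeft_apply]
  by_cases hp : 1 ≤ p
  · rw [if_pos hp, if_pos (by omega), show p - 1 = -(1 - p) by ring]
    congr 3
    simp [idx, kval]
    ring
  · rw [if_neg hp, if_neg (by omega)]
    simp

lemma finsum_gker_trig_at {N : ℕ} (c : ℤ → glC N) (a : ℂ) (L n : ℤ)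
    (hc : ∀ u, u < L → c u = 0) :
    (∑ᶠ p : ℤ, gker true (some a) p • lift (c (n - p))) =
      -∑ᶠ u : ℤ, if u < 0 then (((RatFunc.X : Rf) - RatFunc.C a) ^ u) •
        lift (c (u + n) + a • c (u + n + 1)) else 0 := by
  set A : ℤ → Matrix (Fin N) (Fin N) Rf := fun u =>
    if u < 0 then ((RatFunc.X : Rf) - RatFunc.C a) ^ u • lift (c (u + n)) else 0 with hA
  set B : ℤ → Matrix (Fin N) (Fin N) Rf := fun u =>
    if u < 0 then ((RatFunc.X : Rf) - RatFunc.C a) ^ u • lift (a • c (u + n + 1)) else 0 with hB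
  have hAf : A.support.Finite := support_finite_of_eq_zero (L - n) 0
    (fun u hu => by simp [hA, hc (u + n) (by omega), lift_zero])
    fun u hu => by simp [hA, hu.le]
  have hBf : B.support.Finite := support_finite_of_eq_zero (L - n - 1) 0
    (fun u hu => by simp [hB, hc (u + n + 1) (by omega), lift_zero])
    fun u hu => by simp [hB, hu.le]
  have e1 : (fun u : ℤ => if u < 0 then (((RatFunc.X : Rf) - RatFunc.C a) ^ u) •
        lift (c (u + n) + a • c (u + n + 1)) else 0) = fun u => A u + B u := by
    funext u
    simp only [hA, hB]
    split_ifs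
    · rw [lift_add, smul_add]
    · simp
  have e2 : (fun p : ℤ => gker true (some a) p • lift (c (n - p))) =
      fun p => -(A (Equiv.neg ℤ p) + B (Equiv.subLeft (-1 : ℤ) p)) := by
    funext p
    rw [gker_trig_at, neg_smul, add_smul, mul_comm, mul_smul, ← lift_smul]
    simp only [hA, hB, Equiv.neg_apply, Equiv.subLeft_apply]
    rw [show -p + n = n - p by ring, show -1 - p + n + 1 = n - p by ring,
      show -p - 1 = -1 - p by ring, ite_smul, ite_smul, zero_smul, zero_smul]
    simp only [show -p < 0 ↔ 1 ≤ p by omega, show -1 - p < 0 ↔ 0 ≤ p by omega]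
  rw [e1, e2, finsum_neg_distrib, finsum_add_distrib hAf hBf, finsum_add_distrib,
    finsum_comp_equiv, finsum_comp_equiv]
  · exact hAf.preimage (Equiv.injective _).injOn
  · exact hBf.preimage (Equiv.injective _).injOn

lemma Vlax_trig_at {N : ℕ} (Q : CP1 → ℤ → glC N) (a : ℂ) (n L : ℤ)
    (hQ : ∀ u, u < L → Q (some a) u = 0) :
    Vlax true Q (some a) n
      = - trigNegAtRf a (fun u => Q (some a) (u + n) + a • Q (some a) (u + n + 1)) := by
  have hidx : idx true (some a) n = n := by simp [idx]
  simp only [Vlax, if_true, hidx]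
  rw [finsum_gker_trig_at (Q (some a)) a L n hQ, trigNegAtRf]
  by_cases ha : a = 0
  · subst ha
    simp [sub_eq_add_neg, add_comm]
  · have ht := finsum_telescope ha (fun u => Q (some a) (u + n)) (L - n)
      fun u hu => hQ _ (by omega)
    simp only [add_right_comm _ (1 : ℤ) n, zero_add] at ht
    simp only [if_neg ha]
    rw [ht, lowP_neg, diagP_neg, smul_neg, ← neg_add, lift_neg]
    abel

lemma Vlax_trig_infty {N : ℕ} (Q : CP1 → ℤ → glC N) (n L : ℤ)
    (hQ : ∀ u, u < L → Q none u = 0) :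
    Vlax true Q none n = trigNegInfRf (fun u => Q none (u + n)) := by
  have hidx : idx true none n = n := by simp [idx, kval]
  set A : ℤ → Matrix (Fin N) (Fin N) Rf := fun u =>
    if u < 0 then (RatFunc.X : Rf) ^ (-u) • lift (Q none (u + n)) else 0 with hA
  set B : ℤ → Matrix (Fin N) (Fin N) Rf := fun u =>
    if u = 0 then lift (Q none n) else 0 with hB
  have hAf : A.support.Finite := support_finite_of_eq_zero (L - n) 0
    (fun u hu => by simp [hA, hQ (u + n) (by omega), lift_zero])
    fun u hu => by simp [hA, hu.le]
  have hBf : B.support.Finite := support_finite_of_eq_zero 0 0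
    (fun u hu => by simp [hB, hu.ne]) fun u hu => by simp [hB, hu.ne']
  have e : (fun p : ℤ => gker true none p • lift (Q none (n - p))) =
      fun p => A (Equiv.neg ℤ p) + B (Equiv.neg ℤ p) := by
    funext p
    rw [gker_trig_infty]
    simp only [hA, hB, Equiv.neg_apply]
    rcases lt_trichotomy p 0 with hp | rfl | hp
    · simp [hp.not_ge, hp.ne, hp.le]
    · simp
    · simp [hp, hp.le, hp.ne', sub_eq_neg_add]
  have e' := finsum_comp_equiv (f := fun u => A u + B u) (Equiv.neg ℤ)
  have hBs : ∑ᶠ u, B u = lift (Q none n) := by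
    rw [finsum_eq_single B 0 fun u hu => by simp [hB, hu]]
    simp [hB]
  have hsplit : lift (Q none n) = lift (lowP (Q none n) + (2:ℂ)⁻¹ • diagP (Q none n)) +
      lift (upP (Q none n) + (2:ℂ)⁻¹ • diagP (Q none n)) := by
    rw [← lift_add]
    congr 1
    conv_lhs => rw [← lowP_add_diagP_add_upP (Q none n)]
    module
  simp only [Vlax, if_true, hidx, trigNegInfRf, zero_add]
  rw [e, e', finsum_add_distrib hAf hBf, hBs, hsplit]
  abel

/-- explicit form of the Lax matrices, in the rational and the
trigonometric cases, at finite points and at infinity. -/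
theorem explicit_Lax_matrices (N : ℕ) (Nb : CP1 → ℤ) (Q : CP1 → ℤ → glC N)
    (hQbdd : ∀ b n, n < -(Nb b) → Q b n = 0) :
    (∀ a : ℂ, ∀ n : ℤ, -(Nb (some a)) ≤ n →
      Vlax false Q (some a) n = - ratNegAtRf a (fun u => Q (some a) (u + n + 1))) ∧
    (∀ n : ℤ, -(Nb none) ≤ n →
      Vlax false Q none n = ratNegInfRf (fun u => Q none (u + n))) ∧
    (∀ a : ℂ, ∀ n : ℤ, -(Nb (some a)) ≤ n →
      Vlax true Q (some a) n
        = - trigNegAtRf a (fun u => Q (some a) (u + n) + a • Q (some a) (u + n + 1))) ∧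
    (∀ n : ℤ, -(Nb none) ≤ n →
      Vlax true Q none n = trigNegInfRf (fun u => Q none (u + n))) := by
  exact ⟨fun a n _ => Vlax_rat_at Q a n, fun n _ => Vlax_rat_infty Q n,
    fun a n _ => Vlax_trig_at Q a n _ (hQbdd (some a)),
    fun n _ => Vlax_trig_infty Q n _ (hQbdd none)⟩

end
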